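/- arXiv:2406.09378 — 2 statements merged into one kernel-verified Lean document; each statement's English description precedes it below -/
import Mathlib

section
/- For every n ≥ 1 there is a constant C = C(n) > 0 with the following property (Whitney–Glaeser C^{1,1} extension with scale-invariant bounds). Let R > 0, let G ⊆ closedBall(0,R) ⊆ ℝⁿ be any set, let L₀, L₁, L₂ > 0, and let f : G → ℝ and g : G → ℝⁿ satisfy |f(x)| ≤ L₀ and |g(x)| ≤ L₁ for all x ∈ G, together with the Whitney conditions |g(x) − g(y)| ≤ L₂|x − y| and |f(x) − f(y) − g(y)·(x − y)| ≤ L₂|x − y|² for all x, y ∈ G. Then there exists a function f̃ : ℝⁿ → ℝ, differentiable on closedBall(0,R), such that f̃ = f and ∇f̃ = g on G, and such that sup_{closedBall(0,R)} |f̃| ≤ C(L₀ + R·L₁ + R²·L₂), sup_{closedBall(0,R)} |∇f̃| ≤ C(L₁ + R·L₂), and ∇f̃ is Lipschitz on closedBall(0,R) with Lipschitz constant at most C·L₂. -/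
open Metric
open scoped RealInnerProductSpace

section

variable {E : Type*} [NormedAddCommGroup E] [InnerProductSpace ℝ E]

/-- A function with a first-order Taylor expansion with quadratic error is differentiable. -/
theorem hasGradientAt_of_abs_sub_le_sq [CompleteSpace E] {F : E → ℝ} {x p : E} {K : ℝ}
    (h : ∀ z, |F z - F x - ⟪p, z - x⟫| ≤ K * ‖z - x‖ ^ 2) : HasGradientAt F p x := by
  rw [hasGradientAt_iff_isLittleO]
  refine (Asymptotics.IsBigO.of_bound K (Filter.Eventually.of_forall fun z => ?_)).trans_isLittleO
    (Asymptotics.isLittleO_pow_sub_sub x (m := 2) one_lt_two)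
  simpa using h z

/-- Uniform first-order Taylor expansions with quadratic error have Lipschitz slopes. -/
theorem norm_sub_le_of_abs_sub_le_sq {F : E → ℝ} {P : E → E} {K : ℝ}
    (h : ∀ x z, |F z - F x - ⟪P x, z - x⟫| ≤ K * ‖z - x‖ ^ 2) (x y : E) :
    ‖P x - P y‖ ≤ 6 * K * ‖x - y‖ := by
  rcases eq_or_ne x y with rfl | hxy
  · simp
  rcases eq_or_ne (P x) (P y) with hP | hP
  · have h1 := (abs_nonneg _).trans (h x y)
    have h2 : 0 < ‖y - x‖ := norm_pos_iff.2 (sub_ne_zero.2 hxy.symm)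
    have h3 : 0 ≤ K := nonneg_of_mul_nonneg_left h1 (by positivity)
    rw [hP, sub_self, norm_zero]
    positivity
  have hd : 0 < ‖x - y‖ := norm_pos_iff.2 (sub_ne_zero.2 hxy)
  have hD : 0 < ‖P x - P y‖ := norm_pos_iff.2 (sub_ne_zero.2 hP)
  have h0 : 0 ≤ K :=
    nonneg_of_mul_nonneg_left ((abs_nonneg _).trans (h y x)) (by positivity)
  set v : E := (‖x - y‖ / ‖P x - P y‖) • (P x - P y) with hv
  have hvn : ‖v‖ = ‖x - y‖ := by
    rw [hv, norm_smul, norm_div, norm_norm, norm_norm, div_mul_cancel₀ _ hD.ne']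
  have hvi : ⟪P x - P y, v⟫ = ‖x - y‖ * ‖P x - P y‖ := by
    rw [hv, inner_smul_right, real_inner_self_eq_norm_sq]
    field_simp
  have h1 := abs_le.1 (h y (y + v))
  have h2 := abs_le.1 (h x (y + v))
  have h3 := abs_le.1 (h x y)
  have hn : ‖y + v - x‖ ≤ 2 * ‖x - y‖ := by
    calc ‖y + v - x‖ = ‖v - (x - y)‖ := by congr 1; abel
      _ ≤ ‖v‖ + ‖x - y‖ := norm_sub_le _ _
      _ = 2 * ‖x - y‖ := by rw [hvn]; ring
  have hn2 : K * ‖y + v - x‖ ^ 2 ≤ K * (2 * ‖x - y‖) ^ 2 := by gcongr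
  have e1 : y + v - x = (y - x) + v := by abel
  rw [add_sub_cancel_left, hvn] at h1
  rw [e1, inner_add_right, ← e1] at h2
  rw [norm_sub_rev y x] at h3
  rw [inner_sub_left] at hvi
  have h4 : ‖x - y‖ * ‖P x - P y‖ ≤ ‖x - y‖ * (6 * K * ‖x - y‖) := by
    nlinarith [h1.1, h1.2, h2.1, h2.2, h3.1, h3.2]
  exact le_of_mul_le_mul_left h4 hd

/-- The set of pairs `(c, p)` such that the affine function `c + ⟪p, ·⟫` lies below the function
`f y + ⟪g y, · - y⟫ + K / 2 * ‖· - y‖ ^ 2` for each `y ∈ G`. -/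
def affineMinorants (G : Set E) (f : E → ℝ) (g : E → E) (K : ℝ) : Set (ℝ × E) :=
  {a | ∀ y ∈ G, ∀ z, a.1 + ⟪a.2, z⟫ ≤ f y + ⟪g y, z - y⟫ + K / 2 * ‖z - y‖ ^ 2}

/-- The pointwise supremum of the affine functions in `affineMinorants G f g K`. -/
noncomputable def convexInterpolant (G : Set E) (f : E → ℝ) (g : E → E) (K : ℝ) (x : E) : ℝ :=
  sSup ((fun a : ℝ × E => a.1 + ⟪a.2, x⟫) '' affineMinorants G f g K)

variable {G : Set E} {f : E → ℝ} {g : E → E} {K : ℝ}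

theorem le_convexInterpolant (hG : G.Nonempty) {a : ℝ × E} (ha : a ∈ affineMinorants G f g K)
    (x : E) : a.1 + ⟪a.2, x⟫ ≤ convexInterpolant G f g K x := by
  obtain ⟨y, hy⟩ := hG
  refine le_csSup ⟨f y + ⟪g y, x - y⟫ + K / 2 * ‖x - y‖ ^ 2, ?_⟩ ⟨a, ha, rfl⟩
  rintro _ ⟨b, hb, rfl⟩
  exact hb y hy x

theorem mem_affineMinorants (hK : 0 < K)
    (h : ∀ x ∈ G, ∀ y ∈ G, f y + ⟪g y, x - y⟫ + ‖g x - g y‖ ^ 2 / (2 * K) ≤ f x)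
    {y : E} (hy : y ∈ G) : (f y - ⟪g y, y⟫, g y) ∈ affineMinorants G f g K := by
  intro x hx z
  have h1 := h x hx y hy
  have h2 : 0 ≤ ‖g x - g y‖ ^ 2 / (2 * K) + ⟪g x - g y, z - x⟫ + K / 2 * ‖z - x‖ ^ 2 := by
    have h3 : 0 ≤ ‖(g x - g y) + K • (z - x)‖ ^ 2 / (2 * K) := by positivity
    rw [norm_add_sq_real, norm_smul, inner_smul_right, Real.norm_of_nonneg hK.le] at h3
    convert h3 using 1
    field_simp
  simp only [inner_sub_left, inner_sub_right] at h1 h2 ⊢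
  linarith

theorem nonempty_affineMinorants (hG : G.Nonempty) (hK : 0 < K)
    (h : ∀ x ∈ G, ∀ y ∈ G, f y + ⟪g y, x - y⟫ + ‖g x - g y‖ ^ 2 / (2 * K) ≤ f x) :
    (affineMinorants G f g K).Nonempty :=
  let ⟨_, hy⟩ := hG
  ⟨_, mem_affineMinorants hK h hy⟩

theorem convexInterpolant_le (hA : (affineMinorants G f g K).Nonempty) {y : E} (hy : y ∈ G)
    (x : E) : convexInterpolant G f g K x ≤ f y + ⟪g y, x - y⟫ + K / 2 * ‖x - y‖ ^ 2 := by
  refine csSup_le (hA.image _) ?_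
  rintro _ ⟨a, ha, rfl⟩
  exact ha y hy x

theorem exists_lt_of_lt_convexInterpolant (hA : (affineMinorants G f g K).Nonempty) {x : E}
    {r : ℝ} (hr : r < convexInterpolant G f g K x) :
    ∃ a ∈ affineMinorants G f g K, r < a.1 + ⟪a.2, x⟫ := by
  obtain ⟨_, ⟨a, ha, rfl⟩, h⟩ := exists_lt_of_lt_csSup (hA.image _) hr
  exact ⟨a, ha, h⟩

theorem convexInterpolant_add_le (hG : G.Nonempty) (hA : (affineMinorants G f g K).Nonempty)
    (x v : E) : convexInterpolant G f g K (x + v) + convexInterpolant G f g K (x - v) ≤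
      2 * convexInterpolant G f g K x + K * ‖v‖ ^ 2 := by
  refine le_of_forall_pos_lt_add fun ε hε => ?_
  obtain ⟨a, ha, hax⟩ := exists_lt_of_lt_convexInterpolant hA
    (sub_lt_self (convexInterpolant G f g K (x + v)) (half_pos hε))
  obtain ⟨b, hb, hbx⟩ := exists_lt_of_lt_convexInterpolant hA
    (sub_lt_self (convexInterpolant G f g K (x - v)) (half_pos hε))
  have hc : ((a.1 + b.1 + ⟪a.2, v⟫ - ⟪b.2, v⟫ - K * ‖v‖ ^ 2) / 2, (1 / 2 : ℝ) • (a.2 + b.2)) ∈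
      affineMinorants G f g K := by
    intro y hy z
    have h1 := ha y hy (z + v)
    have h2 := hb y hy (z - v)
    have h3 := parallelogram_law_with_norm ℝ (z - y) v
    rw [show z - y + v = z + v - y by abel, show z - y - v = z - v - y by abel] at h3
    simp only [inner_smul_left, inner_add_left, inner_add_right, inner_sub_right,
      RCLike.conj_to_real] at h1 h2 ⊢
    have h4 : K / 2 * ‖z + v - y‖ ^ 2 + K / 2 * ‖z - v - y‖ ^ 2 =
        K * ‖z - y‖ ^ 2 + K * ‖v‖ ^ 2 := by linear_combination K / 2 * h3
    linarith
  have h1 := le_convexInterpolant hG hc x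
  simp only [inner_smul_left, inner_add_left, inner_add_right, inner_sub_right,
      RCLike.conj_to_real] at h1 hax hbx
  linarith

/-- The convex interpolant has a subgradient at every point. -/
theorem exists_subgradient_convexInterpolant [ProperSpace E] (hG : G.Nonempty) (hK : 0 < K)
    (hA : (affineMinorants G f g K).Nonempty) (x : E) :
    ∃ p : E, ∀ z, convexInterpolant G f g K x + ⟪p, z - x⟫ ≤ convexInterpolant G f g K z := by
  have key : ∀ k : ℕ, ∃ p : E, ∀ z, convexInterpolant G f g K x - 1 / ((k : ℝ) + 1) +
      ⟪p, z - x⟫ ≤ convexInterpolant G f g K z := fun k => by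
    obtain ⟨a, ha, hax⟩ := exists_lt_of_lt_convexInterpolant hA
      (sub_lt_self (convexInterpolant G f g K x) (Nat.one_div_pos_of_nat (α := ℝ) (n := k)))
    refine ⟨a.2, fun z => ?_⟩
    have h1 := le_convexInterpolant hG ha z
    rw [inner_sub_right]
    linarith
  choose p hp using key
  have hbd : ∀ k, p k ∈ closedBall (p 0) (8 * K + 1) := fun k => by
    rw [mem_closedBall, dist_eq_norm]
    set v : E := (1 / (2 * K)) • (p k - p 0) with hv
    have h1 := hp k (x + v)
    have h2 := hp 0 (x - v)
    have h3 := convexInterpolant_add_le hG hA x v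
    have hk : 1 / ((k : ℝ) + 1) ≤ 1 := by
      rw [div_le_one (by positivity)]
      linarith [Nat.cast_nonneg (α := ℝ) k]
    have hi : ⟪p k, v⟫ - ⟪p 0, v⟫ = ‖p k - p 0‖ ^ 2 / (2 * K) := by
      rw [← inner_sub_left, hv, inner_smul_right, real_inner_self_eq_norm_sq]
      ring
    have hn : K * ‖v‖ ^ 2 = ‖p k - p 0‖ ^ 2 / (4 * K) := by
      rw [hv, norm_smul, Real.norm_of_nonneg (by positivity)]
      field_simp
      ring
    rw [add_sub_cancel_left] at h1
    rw [sub_sub_cancel_left, inner_neg_right] at h2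
    norm_num at h2
    have h4 : ‖p k - p 0‖ ^ 2 / (4 * K) ≤ 2 := by
      have : ‖p k - p 0‖ ^ 2 / (2 * K) = 2 * (‖p k - p 0‖ ^ 2 / (4 * K)) := by
        field_simp
        norm_num
      linarith
    rw [div_le_iff₀ (by positivity)] at h4
    nlinarith [norm_nonneg (p k - p 0)]
  obtain ⟨q, -, φ, hφ, hq⟩ := (isCompact_closedBall (p 0) (8 * K + 1)).tendsto_subseq hbd
  refine ⟨q, fun z => ?_⟩
  have hlim : Filter.Tendsto (fun k => convexInterpolant G f g K x - 1 / ((φ k : ℝ) + 1) +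
      ⟪p (φ k), z - x⟫) Filter.atTop
      (nhds (convexInterpolant G f g K x - 0 + ⟪q, z - x⟫)) :=
    (tendsto_const_nhds.sub
      ((tendsto_one_div_add_atTop_nhds_zero_nat (𝕜 := ℝ)).comp hφ.tendsto_atTop)).add
      (hq.inner tendsto_const_nhds)
  rw [sub_zero] at hlim
  exact le_of_tendsto' hlim fun k => hp (φ k) z

/-- Convex `C^{1,1}` extension: the extension is given with its uniform first-order Taylor
expansions. -/
theorem exists_convex_extension [ProperSpace E] (hG : G.Nonempty) (hK : 0 < K)
    (h : ∀ x ∈ G, ∀ y ∈ G, f y + ⟪g y, x - y⟫ + ‖g x - g y‖ ^ 2 / (2 * K) ≤ f x) :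
    ∃ (F : E → ℝ) (P : E → E), (∀ x z, |F z - F x - ⟪P x, z - x⟫| ≤ K * ‖z - x‖ ^ 2) ∧
      (∀ x ∈ G, F x = f x) ∧ ∀ x ∈ G, P x = g x := by
  have hA := nonempty_affineMinorants hG hK h
  set F := convexInterpolant G f g K with hF
  have hlow : ∀ y ∈ G, ∀ z, f y + ⟪g y, z - y⟫ ≤ F z := fun y hy z => by
    have := le_convexInterpolant hG (mem_affineMinorants hK h hy) z
    rw [inner_sub_right]
    linarith
  have hFf : ∀ y ∈ G, F y = f y := fun y hy => by
    refine le_antisymm ?_ ?_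
    · simpa using convexInterpolant_le hA hy y
    · simpa using hlow y hy y
  have hsub : ∀ x, ∃ p, (∀ z, F x + ⟪p, z - x⟫ ≤ F z) ∧ (x ∈ G → p = g x) := fun x => by
    by_cases hx : x ∈ G
    · exact ⟨g x, fun z => by rw [hFf x hx]; exact hlow x hx z, fun _ => rfl⟩
    · obtain ⟨p, hp⟩ := exists_subgradient_convexInterpolant hG hK hA x
      exact ⟨p, hp, fun hx' => absurd hx' hx⟩
  choose P hP hPg using hsub
  refine ⟨F, P, fun x z => ?_, hFf, hPg⟩
  have h1 := hP x z
  have h2 := hP x (x - (z - x))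
  have h3 := convexInterpolant_add_le hG hA x (z - x)
  rw [sub_sub_cancel_left, inner_neg_right] at h2
  rw [add_sub_cancel, ← hF] at h3
  have h4 : 0 ≤ K * ‖z - x‖ ^ 2 := by positivity
  rw [abs_le]
  constructor <;> linarith

/-- `C^{1,1}` extension of a Whitney jet: the extension is given with its uniform first-order
Taylor expansions. -/
theorem exists_whitney_extension [ProperSpace E] (hG : G.Nonempty) {L : ℝ} (hL : 0 < L)
    (hg : ∀ x ∈ G, ∀ y ∈ G, ‖g x - g y‖ ≤ L * ‖x - y‖)
    (hf : ∀ x ∈ G, ∀ y ∈ G, |f x - f y - ⟪g y, x - y⟫| ≤ L * ‖x - y‖ ^ 2) :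
    ∃ (F : E → ℝ) (P : E → E), (∀ x z, |F z - F x - ⟪P x, z - x⟫| ≤ 15 * L * ‖z - x‖ ^ 2) ∧
      (∀ x ∈ G, F x = f x) ∧ ∀ x ∈ G, P x = g x := by
  have hsq : ∀ x y : E, ‖x‖ ^ 2 - ‖y‖ ^ 2 = 2 * ⟪y, x - y⟫ + ‖x - y‖ ^ 2 := fun x y => by
    rw [norm_sub_sq_real, inner_sub_right, real_inner_self_eq_norm_sq, real_inner_comm]
    ring
  have hcw : ∀ x ∈ G, ∀ y ∈ G, (f y + 2 * L * ‖y‖ ^ 2) + ⟪g y + (4 * L) • y, x - y⟫ +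
      ‖(g x + (4 * L) • x) - (g y + (4 * L) • y)‖ ^ 2 / (2 * (13 * L)) ≤
      f x + 2 * L * ‖x‖ ^ 2 := fun x hx y hy => by
    have h1 := (abs_le.1 (hf x hx y hy)).1
    have h2 : ‖(g x + (4 * L) • x) - (g y + (4 * L) • y)‖ ≤ 5 * L * ‖x - y‖ := by
      calc ‖(g x + (4 * L) • x) - (g y + (4 * L) • y)‖
          = ‖(g x - g y) + (4 * L) • (x - y)‖ := by rw [smul_sub]; congr 1; abel
        _ ≤ ‖g x - g y‖ + ‖(4 * L) • (x - y)‖ := norm_add_le _ _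
        _ ≤ L * ‖x - y‖ + 4 * L * ‖x - y‖ := by
          rw [norm_smul, Real.norm_of_nonneg (by positivity)]
          gcongr
          exact hg x hx y hy
        _ = 5 * L * ‖x - y‖ := by ring
    have h3 : ‖(g x + (4 * L) • x) - (g y + (4 * L) • y)‖ ^ 2 / (2 * (13 * L)) ≤
        L * ‖x - y‖ ^ 2 := by
      rw [div_le_iff₀ (by positivity)]
      calc _ ≤ (5 * L * ‖x - y‖) ^ 2 := by gcongr
        _ ≤ _ := by nlinarith [sq_nonneg (L * ‖x - y‖)]
    rw [inner_add_left, inner_smul_left, RCLike.conj_to_real]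
    linear_combination h1 + h3 - 2 * L * hsq x y
  obtain ⟨F, P, hFP, hF, hP⟩ := exists_convex_extension hG (by positivity : 0 < 13 * L) hcw
  refine ⟨fun x => F x - 2 * L * ‖x‖ ^ 2, fun x => P x - (4 * L) • x, fun x z => ?_,
    fun x hx => by simp [hF x hx], fun x hx => by simp [hP x hx]⟩
  have h1 := abs_le.1 (hFP x z)
  have h2 := hsq z x
  have h3 : 0 ≤ L * ‖z - x‖ ^ 2 := by positivity
  simp only [inner_sub_left, inner_smul_left, RCLike.conj_to_real]
  rw [abs_le]
  constructor
  · linear_combination h1.1 + 2 * L * h2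
  · linear_combination h1.2 - 2 * L * h2 + 4 * h3

end

/-- Whitney–Glaeser `C^{1,1}` extension theorem with scale-invariant bounds: data
`f : G → ℝ`, `g : G → ℝⁿ` on a set `G ⊆ closedBall(0,R)` satisfying the Whitney
conditions with constants `L₀, L₁, L₂` extend to a function `f̃`, differentiable on
the closed ball, with `f̃ = f`, `∇f̃ = g` on `G`, with
`sup |f̃| ≤ C(L₀ + R L₁ + R² L₂)`, `sup |∇f̃| ≤ C(L₁ + R L₂)` and `∇f̃`
Lipschitz with constant `C L₂` on the closed ball. -/
theorem whitney_glaeser_C11_extension (n : ℕ) (hn : 1 ≤ n) :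
    ∃ C : ℝ, 0 < C ∧
      ∀ (R : ℝ), 0 < R →
      ∀ (G : Set (EuclideanSpace ℝ (Fin n))),
        G ⊆ closedBall (0 : EuclideanSpace ℝ (Fin n)) R →
      ∀ (L₀ L₁ L₂ : ℝ), 0 < L₀ → 0 < L₁ → 0 < L₂ →
      ∀ (f : EuclideanSpace ℝ (Fin n) → ℝ)
        (g : EuclideanSpace ℝ (Fin n) → EuclideanSpace ℝ (Fin n)),
        (∀ x ∈ G, |f x| ≤ L₀) →
        (∀ x ∈ G, ‖g x‖ ≤ L₁) →
        (∀ x ∈ G, ∀ y ∈ G, ‖g x - g y‖ ≤ L₂ * ‖x - y‖) →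
        (∀ x ∈ G, ∀ y ∈ G, |f x - f y - ⟪g y, x - y⟫| ≤ L₂ * ‖x - y‖ ^ 2) →
        ∃ ft : EuclideanSpace ℝ (Fin n) → ℝ,
          (∀ x ∈ closedBall (0 : EuclideanSpace ℝ (Fin n)) R,
            DifferentiableAt ℝ ft x) ∧
          (∀ x ∈ G, ft x = f x) ∧
          (∀ x ∈ G, gradient ft x = g x) ∧
          (∀ x ∈ closedBall (0 : EuclideanSpace ℝ (Fin n)) R,
            |ft x| ≤ C * (L₀ + R * L₁ + R ^ 2 * L₂)) ∧
          (∀ x ∈ closedBall (0 : EuclideanSpace ℝ (Fin n)) R,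
            ‖gradient ft x‖ ≤ C * (L₁ + R * L₂)) ∧
          (∀ x ∈ closedBall (0 : EuclideanSpace ℝ (Fin n)) R,
            ∀ y ∈ closedBall (0 : EuclideanSpace ℝ (Fin n)) R,
              ‖gradient ft x - gradient ft y‖ ≤ C * L₂ * ‖x - y‖) := by
  refine ⟨400, by norm_num, fun R hR G hGR L₀ L₁ L₂ h₀ h₁ h₂ f g hf₀ hg₁ hg hf => ?_⟩
  rcases G.eq_empty_or_nonempty with rfl | hG
  · refine ⟨fun _ => 0, ?_⟩
    simp only [gradient_fun_const]
    simp
    refine ⟨fun _ _ => by positivity, fun _ _ => by positivity, fun _ _ _ _ => by positivity⟩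
  obtain ⟨F, P, hFP, hF, hP⟩ := exists_whitney_extension hG h₂ hg hf
  have hgrad : ∀ x, HasGradientAt F (P x) x := fun x => hasGradientAt_of_abs_sub_le_sq (hFP x)
  have hlip : ∀ x y, ‖P x - P y‖ ≤ 90 * L₂ * ‖x - y‖ := fun x y => by
    linear_combination norm_sub_le_of_abs_sub_le_sq hFP x y
  obtain ⟨y, hy⟩ := hG
  have hdist : ∀ x ∈ closedBall (0 : EuclideanSpace ℝ (Fin n)) R, ‖x - y‖ ≤ 2 * R :=
    fun x hx => by
      have h1 := mem_closedBall_zero_iff.1 hx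
      have h2 := mem_closedBall_zero_iff.1 (hGR hy)
      linarith [norm_sub_le x y]
  refine ⟨F, fun x _ => (hgrad x).differentiableAt, hF,
    fun x hx => (hgrad x).gradient.trans (hP x hx), fun x hx => ?_, fun x hx => ?_,
    fun x _ z _ => ?_⟩
  · have h1 := abs_le.1 (hFP y x)
    have h2 := abs_le.1 (hf₀ y hy)
    have h3 := abs_le.1 (abs_real_inner_le_norm (P y) (x - y))
    rw [hF y hy] at h1
    have h4 : ‖P y‖ * ‖x - y‖ ≤ L₁ * (2 * R) := by
      rw [hP y hy]
      exact mul_le_mul (hg₁ y hy) (hdist x hx) (norm_nonneg _) h₁.le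
    have h5 : 15 * L₂ * ‖x - y‖ ^ 2 ≤ 15 * L₂ * (2 * R) ^ 2 := by
      gcongr
      exact hdist x hx
    have h6 : 0 < R * L₁ := by positivity
    have h7 : 0 < R ^ 2 * L₂ := by positivity
    rw [abs_le]
    constructor <;> linarith
  · rw [(hgrad x).gradient]
    have h1 := norm_le_norm_add_norm_sub' (P x) (P y)
    have h2 := hlip x y
    have h3 : 90 * L₂ * ‖x - y‖ ≤ 90 * L₂ * (2 * R) := by
      gcongr
      exact hdist x hx
    have h4 := hg₁ y hy
    rw [← hP y hy] at h4
    have h5 : 0 < R * L₂ := by positivity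
    linarith
  · rw [(hgrad x).gradient, (hgrad z).gradient]
    refine (hlip x z).trans ?_
    gcongr
    norm_num
end

section
/- Let V be a nontrivial finite-dimensional real inner product space and let h be a symmetric positive definite bilinear form on V. Then there exists λ > 0 such that for all u, v ∈ V with ‖u‖ = ‖v‖ = 1 one has λ·‖u − v‖² ≤ √(h(u,u)) − h(u,v)/√(h(v,v)). -/
/-- A bilinear form on a finite-dimensional real normed space has a continuous diagonal. -/
theorem continuous_bilinear_diag {V : Type*} [NormedAddCommGroup V] [NormedSpace ℝ V]
    [FiniteDimensional ℝ V] (h : V →ₗ[ℝ] V →ₗ[ℝ] ℝ) : Continuous fun x : V => h x x := by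
  have hc : Continuous fun x : V => LinearMap.toContinuousLinearMap (h x) :=
    (LinearMap.toContinuousLinearMap.toLinearMap ∘ₗ h).continuous_of_finiteDimensional
  exact hc.clm_apply continuous_id

/-- A positive definite bilinear form on a finite-dimensional space is comparable to the square
of the norm. -/
theorem exists_norm_sq_bounds_of_posdef {V : Type*} [NormedAddCommGroup V] [NormedSpace ℝ V]
    [FiniteDimensional ℝ V] [Nontrivial V] (h : V →ₗ[ℝ] V →ₗ[ℝ] ℝ)
    (hpos : ∀ v : V, v ≠ 0 → 0 < h v v) :
    ∃ c C : ℝ, 0 < c ∧ 0 < C ∧ ∀ x : V, c * ‖x‖ ^ 2 ≤ h x x ∧ h x x ≤ C * ‖x‖ ^ 2 := by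
  have hcont := (continuous_bilinear_diag h).continuousOn (s := Metric.sphere (0 : V) 1)
  have hne : (Metric.sphere (0 : V) 1).Nonempty := NormedSpace.sphere_nonempty.2 zero_le_one
  have hcomp : IsCompact (Metric.sphere (0 : V) 1) := isCompact_sphere 0 1
  obtain ⟨p, hp, hmin⟩ := hcomp.exists_isMinOn hne hcont
  obtain ⟨q, hq, hmax⟩ := hcomp.exists_isMaxOn hne hcont
  refine ⟨h p p, h q q, hpos p (ne_zero_of_mem_unit_sphere ⟨p, hp⟩),
    hpos q (ne_zero_of_mem_unit_sphere ⟨q, hq⟩), fun x => ?_⟩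
  rcases eq_or_ne x 0 with rfl | hx
  · simp
  have hx' : ‖x‖ ≠ 0 := norm_ne_zero_iff.2 hx
  have hmem : ‖x‖⁻¹ • x ∈ Metric.sphere (0 : V) 1 := by
    simp [norm_smul, hx']
  have hscale : h x x = h (‖x‖⁻¹ • x) (‖x‖⁻¹ • x) * ‖x‖ ^ 2 := by
    simp only [map_smul, LinearMap.smul_apply, smul_eq_mul]
    field_simp
  rw [hscale]
  exact ⟨mul_le_mul_of_nonneg_right (hmin hmem) (sq_nonneg _),
    mul_le_mul_of_nonneg_right (hmax hmem) (sq_nonneg _)⟩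

/-- For unit vectors, `‖b u - a v‖² ≥ a b ‖u - v‖²`. -/
theorem mul_norm_sub_sq_le_norm_smul_sub_smul_sq {V : Type*} [NormedAddCommGroup V]
    [InnerProductSpace ℝ V] {u v : V} (hu : ‖u‖ = 1) (hv : ‖v‖ = 1) (a b : ℝ) :
    a * b * ‖u - v‖ ^ 2 ≤ ‖b • u - a • v‖ ^ 2 := by
  rw [norm_sub_sq_real, norm_sub_sq_real]
  simp only [norm_smul, real_inner_smul_left, real_inner_smul_right, hu, hv, mul_one,
    Real.norm_eq_abs, sq_abs]
  nlinarith [sq_nonneg (a - b)]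

/-- Coercivity of the anisotropic area integrand `|·|_h = √(h(·,·))` induced by a
symmetric positive definite bilinear form `h` on a nontrivial finite-dimensional real
inner product space: there is `λ > 0` such that
`λ‖u − v‖² ≤ √(h(u,u)) − h(u,v)/√(h(v,v))` for all unit vectors `u, v`. -/
theorem coercivity_of_posdef_bilinear
    (V : Type*) [NormedAddCommGroup V] [InnerProductSpace ℝ V]
    [FiniteDimensional ℝ V] [Nontrivial V]
    (h : V →ₗ[ℝ] V →ₗ[ℝ] ℝ)
    (hsymm : ∀ u v : V, h u v = h v u)
    (hpos : ∀ v : V, v ≠ 0 → 0 < h v v) :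
    ∃ lam : ℝ, 0 < lam ∧
      ∀ u v : V, ‖u‖ = 1 → ‖v‖ = 1 →
        lam * ‖u - v‖ ^ 2 ≤ Real.sqrt (h u u) - h u v / Real.sqrt (h v v) := by
  obtain ⟨c, C, hc, hC, hbound⟩ := exists_norm_sq_bounds_of_posdef h hpos
  refine ⟨c / (2 * √C), by positivity, fun u v hu hv => ?_⟩
  have hu0 : 0 < h u u := hpos u (norm_ne_zero_iff.1 (by simp [hu]))
  have hv0 : 0 < h v v := hpos v (norm_ne_zero_iff.1 (by simp [hv]))
  have hbC : √(h v v) ≤ √C := Real.sqrt_le_sqrt (by simpa [hv] using (hbound v).2)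
  have ha2 : √(h u u) ^ 2 = h u u := Real.sq_sqrt hu0.le
  have hb2 : √(h v v) ^ 2 = h v v := Real.sq_sqrt hv0.le
  have ha : 0 < √(h u u) := Real.sqrt_pos.2 hu0
  have hb : 0 < √(h v v) := Real.sqrt_pos.2 hv0
  set a := √(h u u)
  set b := √(h v v)
  have hexpand : h (b • u - a • v) (b • u - a • v) = 2 * (a * b) * (a * b - h u v) := by
    simp only [map_sub, map_smul, LinearMap.sub_apply, LinearMap.smul_apply, smul_eq_mul,
      ← ha2, ← hb2, hsymm v u]
    ring
  have hkey : a * b * (c * ‖u - v‖ ^ 2) ≤ a * b * (2 * (a * b - h u v)) := by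
    have hnorm := mul_le_mul_of_nonneg_left
      (mul_norm_sub_sq_le_norm_smul_sub_smul_sq hu hv a b) hc.le
    have hlow := (hbound (b • u - a • v)).1
    rw [hexpand] at hlow
    linarith
  have hgap : c * ‖u - v‖ ^ 2 ≤ 2 * (a * b - h u v) :=
    le_of_mul_le_mul_left hkey (mul_pos ha hb)
  calc c / (2 * √C) * ‖u - v‖ ^ 2 ≤ c / (2 * b) * ‖u - v‖ ^ 2 := by gcongr
    _ = c * ‖u - v‖ ^ 2 / (2 * b) := by ring
    _ ≤ 2 * (a * b - h u v) / (2 * b) := by gcongr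
    _ = a - h u v / b := by field_simp
end
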